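/- arXiv:1101.2601 — 2 statements merged into one kernel-verified Lean document; each statement's English description precedes it below -/
import Mathlib

section
/- Assume n > 2σ. The Riesz potential I(x) = ∫_{ℝⁿ} ψ(z)·|x − z|^{2σ−n} dz is finite for every x ∈ ℝⁿ, defines a continuous function on ℝⁿ which is radial (I(x) depends only on |x|), and there exist constants δ > 0, C > 0 and an exponent α with σ < α < min(β, 1) such that for every x with 1/3 − δ < |x| < 1/3 and every x₀ with |x₀| = 1/3, one has |I(x) − I(x₀)| ≤ C·(1 − 3|x|)^α. -/
open MeasureTheory Metric Set

noncomputable section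

/-- Euclidean space `ℝⁿ`. -/
abbrev Eu (n : ℕ) := EuclideanSpace ℝ (Fin n)

/-- The function `ψ(x) = (1 − 3|x|)^{β−2σ}` for `|x| ≤ 1/3`, and `0` for `|x| > 1/3`. -/
def psi (n : ℕ) (β σ : ℝ) (x : Eu n) : ℝ :=
  if ‖x‖ ≤ 1/3 then (1 - 3 * ‖x‖) ^ (β - 2 * σ) else 0

/-- The Riesz potential `I(x) = ∫ ψ(z) |x − z|^{2σ−n} dz`. -/
def rieszPot (n : ℕ) (β σ : ℝ) (x : Eu n) : ℝ :=
  ∫ z : Eu n, psi n β σ z * ‖x - z‖ ^ (2 * σ - (n : ℝ))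

open scoped ENNReal

/-- The function `y ↦ |y|^{-a}` is integrable on intervals of length `2`, uniformly in their
position. -/
theorem exists_setLIntegral_enorm_rpow_neg_le {a : ℝ} (ha : 0 ≤ a) (ha1 : a < 1) :
    ∃ C : ℝ≥0∞, C ≠ ∞ ∧ ∀ c : ℝ, ∫⁻ y in Icc (-1 : ℝ) 1, ‖c - y‖ₑ ^ (-a) ≤ C := by
  set f : ℝ → ℝ≥0∞ := fun y => (ball (0 : ℝ) 1).indicator (fun y => ‖y‖ₑ ^ (-a)) y
  have hfin : ∫⁻ y, f y ≠ ∞ := by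
    have hint : IntegrableOn (fun y : ℝ => |y| ^ (-a)) (ball 0 1) := by
      refine integrableOn_ball_of_norm_le_rpow (C := 1) (α := a) (by simp) (by simpa using ha1)
        (ae_of_all _ fun y => ?_) 
        (Measurable.aestronglyMeasurable (by fun_prop))
      rw [Real.norm_eq_abs, Real.norm_eq_abs, one_mul, abs_of_nonneg (by positivity)]
    have h := hint.2
    rw [hasFiniteIntegral_iff_enorm] at h
    rw [lintegral_indicator measurableSet_ball]
    refine ne_of_lt (lt_of_le_of_lt (lintegral_mono_ae ?_) h)
    have h0 : ∀ᵐ y : ℝ ∂(volume.restrict (ball 0 1)), y ≠ 0 :=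
      ae_restrict_of_ae (Measure.ae_ne volume 0)
    filter_upwards [h0] with y hy
    have hy' : 0 < |y| := abs_pos.2 hy
    rw [← ofReal_norm, Real.norm_eq_abs, ENNReal.ofReal_rpow_of_pos hy', ← ofReal_norm]
    exact ENNReal.ofReal_le_ofReal (le_abs_self _)
  refine ⟨volume (Icc (-1 : ℝ) 1) + ∫⁻ y, f y, by simp [hfin], fun c => ?_⟩
  calc ∫⁻ y in Icc (-1 : ℝ) 1, ‖c - y‖ₑ ^ (-a)
      ≤ ∫⁻ y in Icc (-1 : ℝ) 1, (1 + f (c - y)) := by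
        refine lintegral_mono fun y => ?_
        by_cases h : c - y ∈ ball (0 : ℝ) 1
        · simp only [f, indicator_of_mem h]
          exact le_add_self
        · refine le_trans ?_ le_self_add
          rw [ENNReal.rpow_neg, ENNReal.inv_le_one]
          have h1 : 1 ≤ ‖c - y‖ₑ := by
            rw [← ofReal_norm, ENNReal.one_le_ofReal]
            simpa using h
          calc (1 : ℝ≥0∞) = 1 ^ a := (ENNReal.one_rpow a).symm
            _ ≤ ‖c - y‖ₑ ^ a := by gcongr
    _ = volume (Icc (-1 : ℝ) 1) + ∫⁻ y in Icc (-1 : ℝ) 1, f (c - y) := by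
        rw [lintegral_add_left (by fun_prop)]; simp
    _ ≤ volume (Icc (-1 : ℝ) 1) + ∫⁻ y, f (c - y) := by
        gcongr
        exact Measure.restrict_le_self
    _ = _ := by rw [lintegral_sub_left_eq_self]

theorem ENNReal.rpow_neg_mul_rpow_neg_le {s a : ℝ} (hs : 0 ≤ s) (ha : 0 ≤ a) (u v : ℝ≥0∞) :
    u ^ (-s) * v ^ (-a) ≤ u ^ (-(s + a)) + v ^ (-(s + a)) := by
  have key : ∀ x y : ℝ≥0∞, x ^ s * y ^ a ≤ x ^ (s + a) + y ^ (s + a) := by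
    intro x y
    rcases le_total x y with h | h
    · refine le_trans ?_ le_add_self
      rw [ENNReal.rpow_add_of_nonneg _ _ hs ha]
      gcongr
    · refine le_trans ?_ le_self_add
      rw [ENNReal.rpow_add_of_nonneg _ _ hs ha]
      gcongr
  simpa only [ENNReal.rpow_neg, ENNReal.inv_rpow] using key u⁻¹ v⁻¹

theorem exists_setLIntegral_mul_enorm_rpow_neg_le {s a : ℝ} (hs : 0 ≤ s) (ha : 0 ≤ a)
    (hsa : s + a < 1) :
    ∃ C : ℝ≥0∞, C ≠ ∞ ∧ ∀ b c : ℝ,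
      ∫⁻ y in Icc (-1 : ℝ) 1, ‖b - |y|‖ₑ ^ (-s) * ‖c - y‖ₑ ^ (-a) ≤ C := by
  obtain ⟨C, hC, h⟩ := exists_setLIntegral_enorm_rpow_neg_le (add_nonneg hs ha) hsa
  refine ⟨C + C + C, by simp [hC], fun b c => ?_⟩
  calc ∫⁻ y in Icc (-1 : ℝ) 1, ‖b - |y|‖ₑ ^ (-s) * ‖c - y‖ₑ ^ (-a)
      ≤ ∫⁻ y in Icc (-1 : ℝ) 1, (‖b - y‖ₑ ^ (-(s + a)) + ‖-b - y‖ₑ ^ (-(s + a))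
          + ‖c - y‖ₑ ^ (-(s + a))) := by
        refine lintegral_mono fun y => ?_
        refine (ENNReal.rpow_neg_mul_rpow_neg_le hs ha _ _).trans ?_
        gcongr
        rcases abs_choice y with hy | hy <;> rw [hy]
        · exact le_self_add
        · refine le_trans (le_of_eq ?_) le_add_self
          rw [← enorm_neg]
          congr 2
          ring
    _ = (∫⁻ y in Icc (-1 : ℝ) 1, ‖b - y‖ₑ ^ (-(s + a)))
          + (∫⁻ y in Icc (-1 : ℝ) 1, ‖-b - y‖ₑ ^ (-(s + a)))
          + ∫⁻ y in Icc (-1 : ℝ) 1, ‖c - y‖ₑ ^ (-(s + a)) := by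
        rw [lintegral_add_left (by fun_prop), lintegral_add_left (by fun_prop)]
    _ ≤ C + C + C := by gcongr <;> exact h _

/-- Fubini on a finite power of a measure, integrating one chosen coordinate first. -/
theorem lintegral_pi_le_of_forall_le {m : ℕ} (μ : Measure ℝ) [SigmaFinite μ] (i : Fin (m + 1))
    {g : ℝ → (Fin m → ℝ) → ℝ≥0∞} {h : (Fin m → ℝ) → ℝ≥0∞}
    (hg : Measurable (Function.uncurry g)) {C : ℝ≥0∞} (hC : C ≠ ∞)
    (hgC : ∀ w, ∫⁻ y, g y w ∂μ ≤ C * h w) :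
    ∫⁻ z : Fin (m + 1) → ℝ, g (z i) (i.removeNth z) ∂(Measure.pi fun _ => μ)
      ≤ C * ∫⁻ w, h w ∂(Measure.pi fun _ => μ) := by
  have hmp := measurePreserving_piFinSuccAbove (fun _ : Fin (m + 1) => μ) i
  have := hmp.lintegral_comp hg
  calc _ = ∫⁻ p, Function.uncurry g p ∂(μ.prod (Measure.pi fun _ => μ)) := this
    _ = ∫⁻ w, ∫⁻ y, g y w ∂μ ∂(Measure.pi fun _ => μ) := lintegral_prod_symm' _ hg
    _ ≤ ∫⁻ w, C * h w ∂(Measure.pi fun _ => μ) := lintegral_mono hgC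
    _ = _ := lintegral_const_mul' _ _ hC

theorem lintegral_pi_prod_enorm_rpow_neg_le {μ : Measure ℝ} [SigmaFinite μ] {b : ℝ} {C : ℝ≥0∞}
    (hC : C ≠ ∞) (h : ∀ c : ℝ, ∫⁻ y, ‖c - y‖ₑ ^ (-b) ∂μ ≤ C) (m : ℕ) (x : Fin m → ℝ) :
    ∫⁻ z : Fin m → ℝ, ∏ j, ‖x j - z j‖ₑ ^ (-b) ∂(Measure.pi fun _ => μ) ≤ C ^ m := by
  induction m with
  | zero => simp
  | succ m ih =>
    have key := lintegral_pi_le_of_forall_le (m := m) μ 0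
      (g := fun y w => ‖x 0 - y‖ₑ ^ (-b) * ∏ j, ‖x (Fin.succ j) - w j‖ₑ ^ (-b))
      (h := fun w => ∏ j, ‖x (Fin.succ j) - w j‖ₑ ^ (-b))
      (by simp only [Function.uncurry_def]; fun_prop) hC (fun w => by
        rw [lintegral_mul_const _ (by fun_prop)]
        gcongr
        exact h _)
    simp_rw [Fin.prod_univ_succ]
    refine key.trans ?_
    rw [pow_succ']
    gcongr
    exact ih _

/-- A singularity along the graph `|z i| = B (removeNth i z)` can be absorbed by a point
singularity of the form `|x - z|^{-(a + m b)}` in dimension `m + 1`. -/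
theorem exists_lintegral_pi_mul_prod_le {s a b : ℝ} (hs : 0 ≤ s) (ha : 0 ≤ a) (hsa : s + a < 1)
    (hb : 0 ≤ b) (hb1 : b < 1) (m : ℕ) :
    ∃ C : ℝ≥0∞, C ≠ ∞ ∧ ∀ (i : Fin (m + 1)) (B : (Fin m → ℝ) → ℝ), Measurable B →
      ∀ x : Fin (m + 1) → ℝ,
      ∫⁻ z : Fin (m + 1) → ℝ, ‖B (i.removeNth z) - |z i|‖ₑ ^ (-s) * (‖x i - z i‖ₑ ^ (-a)
        * ∏ j, ‖x (i.succAbove j) - z (i.succAbove j)‖ₑ ^ (-b))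
        ∂(Measure.pi fun _ => volume.restrict (Icc (-1) 1)) ≤ C := by
  obtain ⟨C₁, hC₁, h₁⟩ := exists_setLIntegral_mul_enorm_rpow_neg_le hs ha hsa
  obtain ⟨C₂, hC₂, h₂⟩ := exists_setLIntegral_enorm_rpow_neg_le hb hb1
  refine ⟨C₁ * C₂ ^ m, ENNReal.mul_ne_top hC₁ (ENNReal.pow_ne_top hC₂), fun i B hB x => ?_⟩
  have key := lintegral_pi_le_of_forall_le (volume.restrict (Icc (-1 : ℝ) 1)) i
    (g := fun y w => ‖B w - |y|‖ₑ ^ (-s) * (‖x i - y‖ₑ ^ (-a)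
        * ∏ j, ‖x (i.succAbove j) - w j‖ₑ ^ (-b)))
    (h := fun w => ∏ j, ‖x (i.succAbove j) - w j‖ₑ ^ (-b))
    (by simp only [Function.uncurry_def]; fun_prop) hC₁ (fun w => by
      simp_rw [← mul_assoc]
      rw [lintegral_mul_const _ (by fun_prop)]
      gcongr
      exact h₁ _ _)
  refine key.trans ?_
  gcongr
  exact lintegral_pi_prod_enorm_rpow_neg_le hC₂ h₂ m _

theorem enorm_rpow_neg_le_prod {m : ℕ} {a b : ℝ} (ha : 0 ≤ a) (hb : 0 ≤ b) (i : Fin (m + 1))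
    (w : Eu (m + 1)) :
    ‖w‖ₑ ^ (-(a + m * b)) ≤ ‖w i‖ₑ ^ (-a) * ∏ j, ‖w (i.succAbove j)‖ₑ ^ (-b) := by
  have hw : ∀ k, ‖w k‖ₑ ≤ ‖w‖ₑ := fun k => by
    rw [← ofReal_norm, ← ofReal_norm]
    exact ENNReal.ofReal_le_ofReal (PiLp.norm_apply_le w k)
  have hw' : ∀ (c : ℝ), 0 ≤ c → ∀ k, ‖w‖ₑ⁻¹ ^ c ≤ ‖w k‖ₑ ^ (-c) := fun c hc k => by
    rw [ENNReal.rpow_neg, ← ENNReal.inv_rpow]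
    have := ENNReal.inv_le_inv.2 (hw k)
    gcongr
  calc ‖w‖ₑ ^ (-(a + m * b)) = ‖w‖ₑ⁻¹ ^ a * ∏ _j : Fin m, ‖w‖ₑ⁻¹ ^ b := by
        rw [ENNReal.rpow_neg, ← ENNReal.inv_rpow,
          ENNReal.rpow_add_of_nonneg _ _ ha (by positivity), Finset.prod_const, Finset.card_univ,
          Fintype.card_fin, mul_comm (m : ℝ), ENNReal.rpow_mul, ENNReal.rpow_natCast]
    _ ≤ _ := by
        gcongr
        · exact hw' a ha i
        · exact hw' b hb _

/-- The positive solution `y` of `∑ w j ^ 2 + y ^ 2 = 1 / 9`. -/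
def sphereHeight {m : ℕ} (w : Fin m → ℝ) : ℝ := √(1 / 9 - ∑ j, w j ^ 2)

theorem measurable_sphereHeight {m : ℕ} : Measurable (sphereHeight (m := m)) := by
  unfold sphereHeight
  fun_prop

/-- Inside the ball of radius `1 / 3` the distance to the sphere is comparable to the distance
measured along one of the coordinate axes. -/
theorem exists_sphereHeight_sub_le {m : ℕ} {z : Eu (m + 1)} (hz : ‖z‖ < 1 / 3) :
    ∃ i : Fin (m + 1), 0 < sphereHeight (i.removeNth z) - |z i| ∧
      sphereHeight (i.removeNth z) - |z i| ≤ (m + 1) * (1 - 3 * ‖z‖) := by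
  have hsq : ‖z‖ ^ 2 = ∑ i, z i ^ 2 := EuclideanSpace.real_norm_sq_eq z
  obtain ⟨i, -, hi⟩ : ∃ i ∈ (Finset.univ : Finset (Fin (m + 1))),
      ‖z‖ ^ 2 / (m + 1) ≤ z i ^ 2 := by
    refine Finset.exists_le_of_sum_le Finset.univ_nonempty ?_
    rw [← hsq, Finset.sum_const, Finset.card_univ, Fintype.card_fin, nsmul_eq_mul]
    push_cast
    rw [mul_div_cancel₀ _ (by positivity)]
  refine ⟨i, ?_⟩
  set B := sphereHeight (i.removeNth z) with hB
  set y := |z i|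
  set r := ‖z‖
  have hr0 : 0 ≤ r := norm_nonneg z
  have hy0 : 0 ≤ y := abs_nonneg _
  have hy2 : y ^ 2 = z i ^ 2 := sq_abs _
  have hB0 : 0 ≤ B := Real.sqrt_nonneg _
  have hsum : r ^ 2 = z i ^ 2 + ∑ j, (i.removeNth z j) ^ 2 := by
    rw [hsq, Fin.sum_univ_succAbove _ i]
    rfl
  have hr2 : r ^ 2 < 1 / 9 := by nlinarith
  have hB2 : B ^ 2 = 1 / 9 - r ^ 2 + y ^ 2 := by
    rw [hB, sphereHeight, Real.sq_sqrt]
    · linarith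
    · nlinarith [sq_nonneg (z i)]
  have hpos : 0 < B - y := sub_pos.2 (lt_of_pow_lt_pow_left₀ 2 hB0 (by linarith))
  refine ⟨hpos, ?_⟩
  set N : ℝ := (m : ℝ) + 1
  have hN : 1 ≤ N := by simp [N]
  have hi' : r ^ 2 ≤ N * y ^ 2 := by
    rw [hy2]
    rwa [div_le_iff₀' (by linarith)] at hi
  have hlow : 1 ≤ 3 * N * (B + y) := by
    have h1 : 1 ≤ 9 * N * (B + y) ^ 2 := by
      nlinarith [mul_nonneg hB0 hy0, mul_nonneg (sub_nonneg.2 hN) (sub_nonneg.2 hr2.le),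
        mul_nonneg (zero_le_one.trans hN) (mul_nonneg hB0 hy0)]
    refine (pow_le_pow_iff_left₀ zero_le_one (by positivity) two_ne_zero).1 ?_
    nlinarith [mul_nonneg (sub_nonneg.2 hN) (mul_nonneg (zero_le_one.trans hN) (sq_nonneg (B + y)))]
  have hprod : (B - y) * (B + y) * 9 = (1 - 3 * r) * (1 + 3 * r) := by linarith [hB2]
  calc B - y ≤ (B - y) * (3 * N * (B + y)) := le_mul_of_one_le_right hpos.le hlow
    _ = N / 3 * ((1 - 3 * r) * (1 + 3 * r)) := by rw [← hprod]; ring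
    _ ≤ N / 3 * ((1 - 3 * r) * 3) := by
        gcongr
        · linarith
        · linarith
    _ = N * (1 - 3 * r) := by ring

theorem psi_eq_zero_of_le {n : ℕ} {β σ : ℝ} (h : β < 2 * σ) {z : Eu n} (hz : 1 / 3 ≤ ‖z‖) :
    psi n β σ z = 0 := by
  unfold psi
  split_ifs with h1
  · rw [le_antisymm h1 hz, show (1 : ℝ) - 3 * (1 / 3) = 0 by norm_num,
      Real.zero_rpow (by linarith)]
  · rfl

theorem measurable_psi (n : ℕ) (β σ : ℝ) : Measurable (psi n β σ) := by
  unfold psi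
  exact Measurable.ite (measurableSet_le (by fun_prop) (by fun_prop)) (by fun_prop) (by fun_prop)

theorem exists_enorm_psi_le {m : ℕ} {β σ : ℝ} (h : β < 2 * σ) (z : Eu (m + 1)) :
    ∃ i : Fin (m + 1), ‖psi (m + 1) β σ z‖ₑ ≤ ENNReal.ofReal (((m : ℝ) + 1) ^ (2 * σ - β)) *
      ‖sphereHeight (i.removeNth z) - |z i|‖ₑ ^ (-(2 * σ - β)) := by
  rcases le_or_gt (1 / 3) ‖z‖ with hz | hz
  · exact ⟨0, by simp [psi_eq_zero_of_le h hz]⟩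
  obtain ⟨i, hpos, hle⟩ := exists_sphereHeight_sub_le hz
  refine ⟨i, ?_⟩
  set d := sphereHeight (i.removeNth z) - |z i|
  have hd : 0 < 1 - 3 * ‖z‖ := by linarith
  have hN : (0 : ℝ) < m + 1 := by positivity
  rw [Real.enorm_of_nonneg hpos.le, ENNReal.ofReal_rpow_of_pos hpos,
    ← ENNReal.ofReal_mul (by positivity), psi, if_pos hz.le, Real.enorm_of_nonneg (by positivity)]
  apply ENNReal.ofReal_le_ofReal
  rw [← neg_sub (2 * σ) β]
  set s := 2 * σ - β
  have hs : 0 < s := sub_pos.2 h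
  calc (1 - 3 * ‖z‖) ^ (-s) ≤ (d / (m + 1)) ^ (-s) :=
        Real.rpow_le_rpow_of_nonpos (by positivity) (by rwa [div_le_iff₀' hN]) (by linarith)
    _ = _ := by
        rw [Real.div_rpow hpos.le hN.le, Real.rpow_neg hN.le, div_inv_eq_mul, mul_comm]

/-- The Riesz potential of `psi` of any order `t > 2σ - β` is bounded. -/
theorem exists_lintegral_psi_mul_le {n : ℕ} (hn : 1 ≤ n) {β σ t : ℝ} (h : β < 2 * σ)
    (ht : 2 * σ - β < t) (ht1 : t < 1) :
    ∃ C : ℝ≥0∞, C ≠ ∞ ∧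
      ∀ x : Eu n, ∫⁻ z : Eu n, ‖psi n β σ z‖ₑ * ‖x - z‖ₑ ^ (-((n : ℝ) - t)) ≤ C := by
  obtain ⟨m, rfl⟩ : ∃ m, n = m + 1 := ⟨n - 1, by omega⟩
  set s := 2 * σ - β with hs
  have hs0 : 0 < s := sub_pos.2 h
  obtain ⟨a, b, ha, hsa, hb, hb1, hab⟩ : ∃ a b : ℝ, 0 ≤ a ∧ s + a < 1 ∧ 0 ≤ b ∧ b < 1 ∧
      a + m * b = ((m + 1 : ℕ) : ℝ) - t := by
    rcases Nat.eq_zero_or_pos m with rfl | hm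
    · exact ⟨1 - t, 0, by linarith, by linarith, le_rfl, one_pos, by simp⟩
    · have hm' : (1 : ℝ) ≤ m := by exact_mod_cast hm
      have hm0 : (0 : ℝ) < m := by linarith
      refine ⟨1 - (s + t) / 2, 1 - (t - s) / 2 / m, by linarith, by linarith, ?_, ?_, ?_⟩
      · rw [sub_nonneg, div_le_one hm0]; linarith
      · rw [sub_lt_self_iff]; exact div_pos (by linarith) hm0
      · push_cast; field_simp; ring
  obtain ⟨C, hC, hCle⟩ := exists_lintegral_pi_mul_prod_le hs0.le ha hsa hb hb1 m
  set D : ℝ≥0∞ := ENNReal.ofReal (((m : ℝ) + 1) ^ s)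
  set Q : Set (Fin (m + 1) → ℝ) := Set.pi univ fun _ => Icc (-1) 1
  have hQ : MeasurableSet Q := MeasurableSet.univ_pi fun _ => measurableSet_Icc
  refine ⟨∑ _i : Fin (m + 1), D * C, by simp [hC, D, ENNReal.mul_eq_top], fun x => ?_⟩
  set F : Fin (m + 1) → (Fin (m + 1) → ℝ) → ℝ≥0∞ := fun i z =>
    ‖sphereHeight (i.removeNth z) - |z i|‖ₑ ^ (-s) * (‖x i - z i‖ₑ ^ (-a)
        * ∏ j, ‖x (i.succAbove j) - z (i.succAbove j)‖ₑ ^ (-b))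
  have hF : ∀ i, Measurable (F i) := fun i => by
    have h1 : Measurable fun z : Fin (m + 1) → ℝ => sphereHeight (i.removeNth z) := by
      refine measurable_sphereHeight.comp (measurable_pi_lambda _ fun j => ?_)
      exact measurable_pi_apply _
    fun_prop
  calc ∫⁻ z : Eu (m + 1), ‖psi (m + 1) β σ z‖ₑ * ‖x - z‖ₑ ^ (-(((m + 1 : ℕ) : ℝ) - t))
      = ∫⁻ z : Fin (m + 1) → ℝ, ‖psi (m + 1) β σ (WithLp.toLp 2 z)‖ₑ
          * ‖x - WithLp.toLp 2 z‖ₑ ^ (-(((m + 1 : ℕ) : ℝ) - t)) := by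
        refine ((PiLp.volume_preserving_toLp (Fin (m + 1))).lintegral_comp ?_).symm
        have := measurable_psi (m + 1) β σ
        fun_prop
    _ ≤ ∫⁻ z, Q.indicator (fun z => ∑ i, D * F i z) z := by
        refine lintegral_mono fun z => ?_
        by_cases hz : z ∈ Q
        · rw [indicator_of_mem hz]
          obtain ⟨i, hi⟩ := exists_enorm_psi_le h (WithLp.toLp 2 z)
          refine le_trans ?_ (Finset.single_le_sum (f := fun i => D * F i z)
            (fun _ _ => zero_le) (Finset.mem_univ i))
          simp only [F]
          rw [← mul_assoc, ← hab]
          exact mul_le_mul' hi (enorm_rpow_neg_le_prod ha hb i _)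
        · rw [psi_eq_zero_of_le h, enorm_zero, zero_mul]
          · exact zero_le
          · by_contra! hlt
            refine hz fun i _ => abs_le.1 ?_
            have := PiLp.norm_apply_le (WithLp.toLp 2 z : Eu (m + 1)) i
            rw [Real.norm_eq_abs] at this
            exact this.trans (by linarith)
    _ = ∑ i, D * ∫⁻ z in Q, F i z := by
        rw [lintegral_indicator hQ, lintegral_finsetSum _ fun i _ => (hF i).const_mul D]
        simp_rw [lintegral_const_mul D (hF _)]
    _ ≤ ∑ _i : Fin (m + 1), D * C := by
        gcongr with i
        rw [volume_pi, Measure.restrict_pi_pi]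
        exact hCle i _ measurable_sphereHeight x

theorem abs_rpow_neg_sub_rpow_neg_le {a b p α : ℝ} (ha : 0 < a) (hb : 0 < b) (hp : 0 < p)
    (hα : 0 ≤ α) (hα1 : α ≤ 1) :
    |a ^ (-p) - b ^ (-p)| ≤ (1 + p) * |a - b| ^ α * (a ^ (-(p + α)) + b ^ (-(p + α))) := by
  wlog hab : a ≤ b generalizing a b
  · have := this hb ha (le_of_not_ge hab)
    rwa [abs_sub_comm, abs_sub_comm a b, add_comm (a ^ _)]
  have hmono : b ^ (-p) ≤ a ^ (-p) := Real.rpow_le_rpow_of_nonpos ha hab (by linarith)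
  rw [abs_of_nonneg (sub_nonneg.2 hmono), abs_sub_comm, abs_of_nonneg (sub_nonneg.2 hab)]
  set u := (b - a) / a with hu
  have hu0 : 0 ≤ u := div_nonneg (sub_nonneg.2 hab) ha.le
  have hba : b = a * (1 + u) := by rw [hu]; field_simp; ring
  have hmin : 1 - (1 + u) ^ (-p) ≤ (1 + p) * u ^ α := by
    rcases le_total 1 u with h1 | h1
    · have h2 : 0 ≤ (1 + u) ^ (-p) := by positivity
      have h3 : 1 ≤ u ^ α := Real.one_le_rpow h1 hα
      nlinarith
    · have h2 : u ≤ u ^ α := by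
        rcases hu0.eq_or_lt with h0 | h0
        · rw [← h0]; positivity
        · simpa using Real.rpow_le_rpow_of_exponent_ge h0 h1 hα1
      have h3 : 1 - p * u ≤ (1 + u) ^ (-p) := by
        rw [Real.rpow_def_of_pos (by linarith)]
        have h4 := Real.add_one_le_exp (Real.log (1 + u) * -p)
        have h5 := Real.log_le_sub_one_of_pos (show 0 < 1 + u by linarith)
        nlinarith
      nlinarith
  calc a ^ (-p) - b ^ (-p) = a ^ (-p) * (1 - (1 + u) ^ (-p)) := by
        rw [hba, Real.mul_rpow ha.le (by positivity)]; ring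
    _ ≤ a ^ (-p) * ((1 + p) * u ^ α) := by gcongr
    _ = (1 + p) * (b - a) ^ α * a ^ (-(p + α)) := by
        rw [hu, Real.div_rpow (sub_nonneg.2 hab) ha.le, neg_add, Real.rpow_add ha,
          Real.rpow_neg ha.le α]
        ring
    _ ≤ (1 + p) * (b - a) ^ α * (a ^ (-(p + α)) + b ^ (-(p + α))) := by
        have : 0 ≤ b - a := sub_nonneg.2 hab
        gcongr
        exact le_add_of_nonneg_right (by positivity)

theorem enorm_norm_rpow_neg_sub_le {E : Type*} [NormedAddCommGroup E] {p α : ℝ} (hp : 0 < p)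
    (hα : 0 ≤ α) (hα1 : α ≤ 1) (u v : E) :
    ‖‖u‖ ^ (-p) - ‖v‖ ^ (-p)‖ₑ ≤ ENNReal.ofReal (1 + p) * ‖u - v‖ₑ ^ α *
      (‖u‖ₑ ^ (-(p + α)) + ‖v‖ₑ ^ (-(p + α))) := by
  rcases eq_or_ne u v with rfl | huv
  · simp
  have hneg : -(p + α) < 0 := by linarith
  have hc : ENNReal.ofReal (1 + p) * ‖u - v‖ₑ ^ α ≠ 0 := by
    refine mul_ne_zero (by simpa using by linarith) ?_
    simp [ENNReal.rpow_eq_zero_iff, sub_eq_zero, huv]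
  rcases eq_or_ne u 0 with rfl | hu
  · simp only [enorm_zero, ENNReal.zero_rpow_of_neg hneg, top_add, ENNReal.mul_top hc, le_top]
  rcases eq_or_ne v 0 with rfl | hv
  · simp only [enorm_zero, ENNReal.zero_rpow_of_neg hneg, add_top, ENNReal.mul_top hc, le_top]
  have hu' : 0 < ‖u‖ := norm_pos_iff.2 hu
  have hv' : 0 < ‖v‖ := norm_pos_iff.2 hv
  have huv' : 0 < ‖u - v‖ := norm_pos_iff.2 (sub_ne_zero.2 huv)
  rw [← ofReal_norm, ← ofReal_norm, ← ofReal_norm, ← ofReal_norm, ENNReal.ofReal_rpow_of_pos hu',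
    ENNReal.ofReal_rpow_of_pos hv', ENNReal.ofReal_rpow_of_pos huv',
    ← ENNReal.ofReal_add (by positivity) (by positivity), ← ENNReal.ofReal_mul (by positivity),
    ← ENNReal.ofReal_mul (by positivity), Real.norm_eq_abs]
  apply ENNReal.ofReal_le_ofReal
  refine (abs_rpow_neg_sub_rpow_neg_le hu' hv' hp hα hα1).trans ?_
  gcongr
  exact abs_norm_sub_norm_le u v

theorem enorm_norm_rpow_neg_le {E : Type*} [NormedAddCommGroup E] {p α R : ℝ} (hp : 0 < p)
    (hα : 0 ≤ α) {u : E} (hu : ‖u‖ ≤ R) :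
    ‖‖u‖ ^ (-p)‖ₑ ≤ ENNReal.ofReal (R ^ α) * ‖u‖ₑ ^ (-(p + α)) := by
  rcases eq_or_ne u 0 with rfl | hu0
  · simp [Real.zero_rpow (neg_ne_zero.2 hp.ne')]
  have hu' : 0 < ‖u‖ := norm_pos_iff.2 hu0
  have hR : 0 < R := hu'.trans_le hu
  rw [← ofReal_norm, ← ofReal_norm, ENNReal.ofReal_rpow_of_pos hu',
    ← ENNReal.ofReal_mul (by positivity), Real.norm_of_nonneg (by positivity)]
  apply ENNReal.ofReal_le_ofReal
  calc ‖u‖ ^ (-p) = ‖u‖ ^ α * ‖u‖ ^ (-(p + α)) := by rw [← Real.rpow_add hu']; ring_nf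
    _ ≤ _ := by gcongr

section Potential

variable {n : ℕ} {σ β α : ℝ}

theorem integrable_psi_mul_norm_rpow (hn : 1 ≤ n) (hn2σ : 2 * σ < n) (h : β < 2 * σ)
    (hα : 0 ≤ α) (hα1 : 2 * σ - α < 1) (hαβ : α < β) (x : Eu n) :
    Integrable fun z : Eu n => psi n β σ z * ‖x - z‖ ^ (2 * σ - (n : ℝ)) := by
  obtain ⟨C, hC, hCle⟩ := exists_lintegral_psi_mul_le hn h (t := 2 * σ - α) (by linarith) hα1
  have hψ := measurable_psi n β σ
  refine ⟨Measurable.aestronglyMeasurable (by fun_prop), ?_⟩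
  rw [hasFiniteIntegral_iff_enorm]
  calc ∫⁻ z : Eu n, ‖psi n β σ z * ‖x - z‖ ^ (2 * σ - (n : ℝ))‖ₑ
      ≤ ∫⁻ z : Eu n, ENNReal.ofReal ((‖x‖ + 1) ^ α) *
          (‖psi n β σ z‖ₑ * ‖x - z‖ₑ ^ (-((n : ℝ) - (2 * σ - α)))) := by
        refine lintegral_mono fun z => ?_
        rcases le_or_gt (1 / 3) ‖z‖ with hz | hz
        · simp [psi_eq_zero_of_le h hz]
        rw [enorm_mul, mul_left_comm]
        gcongr
        have := enorm_norm_rpow_neg_le (p := n - 2 * σ) (sub_pos.2 hn2σ) hα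
          (u := x - z) (R := ‖x‖ + 1) ((norm_sub_le x z).trans (by linarith))
        rwa [neg_sub, show (n : ℝ) - 2 * σ + α = n - (2 * σ - α) by ring] at this
    _ = ENNReal.ofReal ((‖x‖ + 1) ^ α) *
          ∫⁻ z : Eu n, ‖psi n β σ z‖ₑ * ‖x - z‖ₑ ^ (-((n : ℝ) - (2 * σ - α))) :=
        lintegral_const_mul _ (by fun_prop)
    _ ≤ ENNReal.ofReal ((‖x‖ + 1) ^ α) * C := by gcongr; exact hCle x
    _ < ∞ := ENNReal.mul_lt_top ENNReal.ofReal_lt_top hC.lt_top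

theorem exists_abs_rieszPot_sub_le (hn : 1 ≤ n) (hn2σ : 2 * σ < n) (h : β < 2 * σ)
    (hα : 0 ≤ α) (hα1 : α ≤ 1) (hα2 : 2 * σ - α < 1) (hαβ : α < β) :
    ∃ C : ℝ, 0 ≤ C ∧ ∀ x y : Eu n, |rieszPot n β σ x - rieszPot n β σ y| ≤ C * ‖x - y‖ ^ α := by
  obtain ⟨C, hC, hCle⟩ := exists_lintegral_psi_mul_le hn h (t := 2 * σ - α) (by linarith) hα2
  have hψ := measurable_psi n β σ
  set A : ℝ≥0∞ := ENNReal.ofReal (1 + (n - 2 * σ))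
  have hA : A * (C + C) ≠ ∞ := ENNReal.mul_ne_top ENNReal.ofReal_ne_top (by simp [hC])
  refine ⟨(A * (C + C)).toReal, ENNReal.toReal_nonneg, fun x y => ?_⟩
  have hint := integrable_psi_mul_norm_rpow hn hn2σ h hα hα2 hαβ
  have hexp : (n : ℝ) - 2 * σ + α = n - (2 * σ - α) := by ring
  have key : ‖rieszPot n β σ x - rieszPot n β σ y‖ₑ ≤ A * (C + C) * ‖x - y‖ₑ ^ α := by
    rw [rieszPot, rieszPot, ← integral_sub (hint x) (hint y)]
    refine (enorm_integral_le_lintegral_enorm _).trans ?_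
    calc ∫⁻ z : Eu n, ‖psi n β σ z * ‖x - z‖ ^ (2 * σ - (n : ℝ))
            - psi n β σ z * ‖y - z‖ ^ (2 * σ - (n : ℝ))‖ₑ
        ≤ ∫⁻ z : Eu n, A * ‖x - y‖ₑ ^ α *
            (‖psi n β σ z‖ₑ * ‖x - z‖ₑ ^ (-((n : ℝ) - (2 * σ - α)))
              + ‖psi n β σ z‖ₑ * ‖y - z‖ₑ ^ (-((n : ℝ) - (2 * σ - α)))) := by
          refine lintegral_mono fun z => ?_
          rw [← mul_sub, enorm_mul, ← mul_add, mul_left_comm]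
          gcongr
          have := enorm_norm_rpow_neg_sub_le (p := n - 2 * σ) (sub_pos.2 hn2σ) hα hα1
            (x - z) (y - z)
          rwa [neg_sub, hexp, sub_sub_sub_cancel_right] at this
      _ = A * ‖x - y‖ₑ ^ α *
            (∫⁻ z : Eu n, ‖psi n β σ z‖ₑ * ‖x - z‖ₑ ^ (-((n : ℝ) - (2 * σ - α)))
              + ‖psi n β σ z‖ₑ * ‖y - z‖ₑ ^ (-((n : ℝ) - (2 * σ - α)))) :=
          lintegral_const_mul _ (by fun_prop)
      _ ≤ A * ‖x - y‖ₑ ^ α * (C + C) := by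
          rw [lintegral_add_left (by fun_prop)]
          gcongr <;> exact hCle _
      _ = _ := by ring
  rw [← ofReal_norm (x - y), ENNReal.ofReal_rpow_of_nonneg (norm_nonneg _) hα,
    ← ENNReal.ofReal_toReal hA, ← ENNReal.ofReal_mul ENNReal.toReal_nonneg,
    ← ofReal_norm, Real.norm_eq_abs] at key
  exact (ENNReal.ofReal_le_ofReal_iff (by positivity)).1 key

theorem rieszPot_eq_of_norm_eq (n : ℕ) (β σ : ℝ) {x y : Eu n} (hxy : ‖x‖ = ‖y‖) :
    rieszPot n β σ x = rieszPot n β σ y := by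
  set e : Eu n ≃ₗᵢ[ℝ] Eu n := (ℝ ∙ (x - y))ᗮ.reflection
  have he : e x = y := Submodule.reflection_sub hxy
  rw [rieszPot, rieszPot, ← e.measurePreserving.integral_comp e.toHomeomorph.measurableEmbedding
    fun z => psi n β σ z * ‖y - z‖ ^ (2 * σ - (n : ℝ))]
  refine integral_congr_ae (ae_of_all _ fun z => ?_)
  simp only [psi]
  rw [← he, ← map_sub, e.norm_map, e.norm_map]

end Potential

/-- **Regularity of the Riesz potential of `ψ`.**  If `n > 2σ` then `I = I_{2σ}ψ` is finite
everywhere (the defining integrand is integrable), continuous and radial, and there are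
`δ > 0`, `C > 0` and `α ∈ (σ, min(β,1))` such that `|I(x) − I(x₀)| ≤ C (1 − 3|x|)^α`
whenever `1/3 − δ < |x| < 1/3` and `|x₀| = 1/3`. -/
theorem riesz_potential_regularity (n : ℕ) (hn : 1 ≤ n) (σ γ β : ℝ)
    (hσ : 0 < σ) (hσ1 : σ < 1) (hγ : 0 < γ) (hγ1 : γ < 1)
    (hβ : β = 2 * σ / (2 - γ)) (hn2σ : 2 * σ < (n : ℝ)) :
    (∀ x : Eu n, Integrable (fun z : Eu n => psi n β σ z * ‖x - z‖ ^ (2 * σ - (n : ℝ)))) ∧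
    Continuous (rieszPot n β σ) ∧
    (∀ x₁ x₂ : Eu n, ‖x₁‖ = ‖x₂‖ → rieszPot n β σ x₁ = rieszPot n β σ x₂) ∧
    (∃ δ > (0:ℝ), ∃ C > (0:ℝ), ∃ α : ℝ, σ < α ∧ α < min β 1 ∧
      ∀ x x₀ : Eu n, 1/3 - δ < ‖x‖ → ‖x‖ < 1/3 → ‖x₀‖ = 1/3 →
        |rieszPot n β σ x - rieszPot n β σ x₀| ≤ C * (1 - 3 * ‖x‖) ^ α) := by
  have hβ' : β * (2 - γ) = 2 * σ := by rw [hβ]; field_simp [show (2 : ℝ) - γ ≠ 0 by linarith]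
  have hβ0 : 0 < β := by rw [hβ]; exact div_pos (by linarith) (by linarith)
  have h2σ : β < 2 * σ := by nlinarith
  have hσβ : σ < min β 1 := lt_min (by nlinarith) hσ1
  obtain ⟨α, hσα, hαβ⟩ := exists_between hσβ
  have hα : 0 < α := hσ.trans hσα
  have hαβ' : α < β := hαβ.trans_le (min_le_left _ _)
  have hα1 : α < 1 := hαβ.trans_le (min_le_right _ _)
  obtain ⟨C, hC, hCle⟩ :=
    exists_abs_rieszPot_sub_le hn hn2σ h2σ hα.le hα1.le (by linarith) hαβ'
  refine ⟨integrable_psi_mul_norm_rpow hn hn2σ h2σ hα.le (by linarith) hαβ', ?_,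
    fun _ _ => rieszPot_eq_of_norm_eq n β σ, 1 / 6, by norm_num, C + 1, by linarith, α, hσα, hαβ,
    fun x x₀ hx hx1 hx₀ => ?_⟩
  · rw [continuous_iff_continuousAt]
    intro y
    rw [ContinuousAt, tendsto_iff_dist_tendsto_zero]
    have hlim : Filter.Tendsto (fun x : Eu n => C * ‖x - y‖ ^ α) (nhds y) (nhds 0) := by
      have hcont : Continuous fun x : Eu n => C * ‖x - y‖ ^ α :=
        continuous_const.mul
          ((continuous_id.sub continuous_const).norm.rpow_const fun _ => Or.inr hα.le)
      simpa [Real.zero_rpow hα.ne'] using hcont.tendsto y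
    exact squeeze_zero (fun _ => dist_nonneg) (fun x => hCle x y) hlim
  · have hx0 : 0 < ‖x‖ := by linarith
    set y : Eu n := (1 / (3 * ‖x‖)) • x
    have hy : ‖y‖ = 1 / 3 := by
      rw [norm_smul, Real.norm_of_nonneg (by positivity)]
      field_simp
    have hxy : ‖x - y‖ = (1 - 3 * ‖x‖) / 3 := by
      rw [show x - y = (1 - 1 / (3 * ‖x‖)) • x by rw [sub_smul, one_smul], norm_smul,
        Real.norm_of_nonpos]
      · field_simp
        ring
      · rw [sub_nonpos, le_div_iff₀ (by positivity)]
        linarith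
    rw [rieszPot_eq_of_norm_eq n β σ (hx₀.trans hy.symm)]
    have hd : 0 ≤ 1 - 3 * ‖x‖ := by linarith
    refine (hCle x y).trans ?_
    gcongr
    · linarith
    · rw [hxy]
      linarith
end
end

section
/- (Weighted Poincaré inequality.) Let a ∈ (−1, 1) and ε > 0. There exists a constant C, depending only on n, a and ε, such that every Lipschitz function u on the closed unit ball B₁ ⊂ ℝ^{n+1} whose zero set {X ∈ B₁ : u(X) = 0} has (n+1)-dimensional Lebesgue measure at least ε·|B₁| satisfies ∫_{B₁} |y|^a · u(X)² dX ≤ C · ∫_{B₁} |y|^a · |∇u(X)|² dX, where X = (x, y) with x ∈ ℝⁿ, y ∈ ℝ. -/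
open MeasureTheory Metric Set

noncomputable section

/-- Euclidean space `ℝ^{n+1}`. -/
abbrev E (n : ℕ) := EuclideanSpace ℝ (Fin (n + 1))

/-- The vertical coordinate `y` of a point `X ∈ ℝ^{n+1}`. -/
def yco {n : ℕ} (X : E n) : ℝ := X (Fin.last n)

open scoped ENNReal

/-- The weight `|s|^p` as an extended nonnegative real. -/
def absPow (p s : ℝ) : ℝ≥0∞ := ENNReal.ofReal (|s| ^ p)

@[fun_prop]
lemma measurable_absPow (p : ℝ) : Measurable (absPow p) := by
  unfold absPow; fun_prop

@[fun_prop]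
lemma measurable_yco {n : ℕ} : Measurable (yco : E n → ℝ) := by
  unfold yco; fun_prop

lemma yco_add {n : ℕ} (X Y : E n) : yco (X + Y) = yco X + yco Y := rfl

lemma yco_sub {n : ℕ} (X Y : E n) : yco (X - Y) = yco X - yco Y := rfl

lemma yco_smul {n : ℕ} (t : ℝ) (X : E n) : yco (t • X) = t * yco X := rfl

lemma abs_coord_le_one {n : ℕ} {X : E n} (hX : X ∈ closedBall (0 : E n) 1) (i : Fin (n + 1)) :
    |X i| ≤ 1 := by
  rw [mem_closedBall, dist_zero_right] at hX
  simpa using (PiLp.norm_apply_le X i).trans hX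

/-- Translates of `|s|^{-b}`, `b < 1`, are uniformly integrable over `[-1, 1]`. -/
lemma exists_lintegral_absPow_sub_le {b : ℝ} (hb0 : 0 ≤ b) (hb1 : b < 1) :
    ∃ K : ℝ≥0∞, K ≠ ⊤ ∧ ∀ c : ℝ, ∫⁻ s in Icc (-1 : ℝ) 1, absPow (-b) (s - c) ≤ K := by
  set J : ℝ → ℝ≥0∞ := (Ioc (0 : ℝ) 1).indicator fun s => ENNReal.ofReal (s ^ (-b)) with hJ
  have hJm : Measurable J := by
    apply Measurable.indicator _ measurableSet_Ioc
    fun_prop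
  have hbound : ∀ s, absPow (-b) s ≤ 1 + (J s + J (-s)) := by
    intro s
    unfold absPow
    by_cases h1 : 1 < |s|
    · refine le_trans ?_ le_self_add
      rw [ENNReal.ofReal_le_one]
      exact Real.rpow_le_one_of_one_le_of_nonpos h1.le (by linarith)
    push Not at h1
    rcases lt_trichotomy s 0 with h | h | h
    · rw [abs_of_neg h] at h1 ⊢
      have : J (-s) = ENNReal.ofReal ((-s) ^ (-b)) := by
        rw [hJ, indicator_of_mem]
        exact ⟨by linarith, h1⟩
      rw [← this, ← add_assoc]
      exact le_add_self
    · subst h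
      refine le_trans ?_ le_self_add
      rw [ENNReal.ofReal_le_one, abs_zero]
      exact Real.zero_rpow_le_one _
    · rw [abs_of_pos h] at h1 ⊢
      have : J s = ENNReal.ofReal (s ^ (-b)) := by
        rw [hJ, indicator_of_mem]
        exact ⟨by linarith, h1⟩
      rw [← this, add_comm (J s), ← add_assoc]
      exact le_add_self
  have hJfin : ∫⁻ s, J s ≠ ⊤ := by
    rw [hJ, lintegral_indicator measurableSet_Ioc]
    have h := (intervalIntegral.intervalIntegrable_rpow' (a := 0) (b := 1) (r := -b)
      (by linarith)).1
    refine ne_of_lt (lt_of_le_of_lt (lintegral_mono fun s => ?_) h.2)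
    exact Real.ofReal_le_enorm _
  refine ⟨2 + ((∫⁻ s, J s) + ∫⁻ s, J s), by finiteness, fun c => ?_⟩
  calc ∫⁻ s in Icc (-1 : ℝ) 1, absPow (-b) (s - c)
      ≤ ∫⁻ s in Icc (-1 : ℝ) 1, (1 + (J (s - c) + J (c - s))) := by
        refine lintegral_mono fun s => ?_
        simpa using hbound (s - c)
    _ = 2 + ∫⁻ s in Icc (-1 : ℝ) 1, (J (s - c) + J (c - s)) := by
        rw [lintegral_add_left measurable_const]
        congr 1
        simp
        norm_num
    _ ≤ 2 + ∫⁻ s, (J (s - c) + J (c - s)) := by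
        gcongr
        exact Measure.restrict_le_self
    _ = _ := by
        rw [lintegral_add_left (by fun_prop), lintegral_sub_right_eq_self J c,
          lintegral_sub_left_eq_self J c]

lemma lintegral_closedBall_yco_le {n : ℕ} {f : ℝ → ℝ≥0∞} (hf : Measurable f) :
    ∫⁻ X in closedBall (0 : E n) 1, f (yco X) ≤ 2 ^ n * ∫⁻ s in Icc (-1 : ℝ) 1, f s := by
  have hmp := PiLp.volume_preserving_ofLp (Fin (n + 1))
  calc ∫⁻ X in closedBall (0 : E n) 1, f (yco X)
      ≤ ∫⁻ X in (WithLp.ofLp : E n → _) ⁻¹' (univ.pi fun _ => Icc (-1 : ℝ) 1), f (yco X) := by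
        refine lintegral_mono_set fun X hX => ?_
        simp only [mem_preimage, mem_univ_pi]
        exact fun i => abs_le.1 (abs_coord_le_one hX i)
    _ = ∫⁻ x in (univ.pi fun _ : Fin (n + 1) => Icc (-1 : ℝ) 1), f (x (Fin.last n)) := by
        rw [← hmp.setLIntegral_comp_preimage (MeasurableSet.univ_pi fun _ => measurableSet_Icc)
          (by fun_prop)]
        rfl
    _ = 2 ^ n * ∫⁻ s in Icc (-1 : ℝ) 1, f s := by
        have key : Measure.map (fun x : Fin (n + 1) → ℝ => x (Fin.last n))
            (Measure.pi fun _ : Fin (n + 1) => (volume : Measure ℝ).restrict (Icc (-1 : ℝ) 1))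
            = (2 ^ n : ℝ≥0∞) • volume.restrict (Icc (-1 : ℝ) 1) := by
          have := Measure.pi_map_eval
            (fun _ : Fin (n + 1) => (volume : Measure ℝ).restrict (Icc (-1 : ℝ) 1)) (Fin.last n)
          refine this.trans ?_
          congr 1
          simp
          norm_num
        rw [volume_pi, Measure.restrict_pi_pi, ← smul_eq_mul, ← lintegral_smul_measure, ← key,
          lintegral_map hf (measurable_pi_apply (Fin.last n))]

lemma exists_lintegral_closedBall_absPow_sub_le (n : ℕ) {b : ℝ} (hb0 : 0 ≤ b) (hb1 : b < 1) :
    ∃ K : ℝ≥0∞, K ≠ ⊤ ∧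
      ∀ c : ℝ, ∫⁻ X in closedBall (0 : E n) 1, absPow (-b) (yco X - c) ≤ K := by
  obtain ⟨K, hK, h⟩ := exists_lintegral_absPow_sub_le hb0 hb1
  refine ⟨2 ^ n * K, by finiteness, fun c => ?_⟩
  refine (lintegral_closedBall_yco_le (f := fun s => absPow (-b) (s - c)) (by fun_prop)).trans ?_
  gcongr
  exact h c

lemma ae_closedBall_yco_ne_zero (n : ℕ) :
    ∀ᵐ X ∂(volume.restrict (closedBall (0 : E n) 1)), yco X ≠ 0 := by
  have h := lintegral_closedBall_yco_le (n := n) (f := ({0} : Set ℝ).indicator 1)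
    (measurable_one.indicator (measurableSet_singleton 0))
  rw [lintegral_indicator_one (measurableSet_singleton _)] at h
  simp only [measure_singleton, mul_zero, nonpos_iff_eq_zero] at h
  rw [lintegral_eq_zero_iff (by
    exact (measurable_one.indicator (measurableSet_singleton 0)).comp measurable_yco)] at h
  filter_upwards [h] with X hX hX0
  simp [hX0] at hX

lemma lintegral_comp_smul_add_le {n : ℕ} {h : E n → ℝ≥0∞} (hh : Measurable h) {s : ℝ}
    (hs : 1 / 2 ≤ s) (W : E n) :
    ∫⁻ X, h (s • X + W) ≤ 2 ^ (n + 1) * ∫⁻ X, h X := by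
  have hs0 : 0 < s := by linarith
  have := lintegral_map (μ := (volume : Measure (E n))) (f := fun X => h (X + W)) (g := (s • ·))
    (by fun_prop) (by fun_prop)
  rw [← this, Measure.map_addHaar_smul _ hs0.ne', lintegral_smul_measure,
    lintegral_add_right_eq_self h W, smul_eq_mul]
  gcongr
  rw [finrank_euclideanSpace_fin, abs_of_pos (by positivity), ← inv_pow,
    ENNReal.ofReal_pow (by positivity)]
  gcongr
  rw [ENNReal.ofReal_le_ofNat]
  rw [inv_le_comm₀ hs0 (by norm_num)]
  linarith
lemma absPow_sub_div_le {b : ℝ} (hb0 : 0 ≤ b) {t : ℝ} (ht : t ∈ Ioo (0 : ℝ) 1) (y z : ℝ) :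
    absPow (-b) ((1 - t)⁻¹ * (y - t * z)) ≤ absPow (-b) t * absPow (-b) (z - t⁻¹ * y) := by
  obtain ⟨ht0, ht1⟩ := ht
  unfold absPow
  rw [← ENNReal.ofReal_mul (by positivity), ← Real.mul_rpow (abs_nonneg _) (abs_nonneg _),
    ← abs_mul]
  apply ENNReal.ofReal_le_ofReal
  have h1 : |t * (z - t⁻¹ * y)| = |y - t * z| := by
    rw [← abs_neg]
    congr 1
    field_simp
    ring
  rw [h1]
  rcases eq_or_ne (y - t * z) 0 with h | h
  · simp [h]
  · apply Real.rpow_le_rpow_of_nonpos (abs_pos.2 h) _ (by linarith)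
    rw [abs_mul]
    apply le_mul_of_one_le_left (abs_nonneg _)
    rw [abs_of_pos (by rw [inv_pos]; linarith)]
    exact (one_le_inv₀ (by linarith)).2 (by linarith)

lemma lintegral_absPow_mul_comp_segment_le {n : ℕ} {b : ℝ} (hb0 : 0 ≤ b) {K : ℝ≥0∞}
    (hK : ∀ c : ℝ, ∫⁻ X in closedBall (0 : E n) 1, absPow (-b) (yco X - c) ≤ K)
    {g : E n → ℝ≥0∞} (hg : Measurable g) {t : ℝ} (ht : t ∈ Ioo (0 : ℝ) 1) :
    ∫⁻ X in closedBall (0 : E n) 1, ∫⁻ Z in closedBall (0 : E n) 1,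
        absPow (-b) (yco X) * g (X + t • (Z - X))
      ≤ 2 ^ (n + 1) * K * (1 + absPow (-b) t) * ∫⁻ Y in closedBall (0 : E n) 1, g Y := by
  set B := closedBall (0 : E n) 1 with hB
  have hBm : MeasurableSet B := measurableSet_closedBall
  set G : E n → ℝ≥0∞ := B.indicator g with hG
  have hGm : Measurable G := hg.indicator hBm
  have hGint : ∫⁻ Y in B, g Y = ∫⁻ Y, G Y := (lintegral_indicator hBm _).symm
  have hseg : ∀ X ∈ B, ∀ Z ∈ B, g (X + t • (Z - X)) = G (X + t • (Z - X)) := by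
    intro X hX Z hZ
    rw [hG, indicator_of_mem]
    exact (convex_closedBall (0 : E n) 1).add_smul_sub_mem hX hZ ⟨ht.1.le, ht.2.le⟩
  have hrw : ∫⁻ X in B, ∫⁻ Z in B, absPow (-b) (yco X) * g (X + t • (Z - X))
      = ∫⁻ X in B, ∫⁻ Z in B, absPow (-b) (yco X) * G (X + t • (Z - X)) := by
    refine setLIntegral_congr_fun hBm fun X hX => ?_
    refine setLIntegral_congr_fun hBm fun Z hZ => ?_
    simp only [hseg X hX Z hZ]
  rw [hrw, hGint]
  rcases le_or_gt (1 / 2) t with h | h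
  · calc ∫⁻ X in B, ∫⁻ Z in B, absPow (-b) (yco X) * G (X + t • (Z - X))
        ≤ ∫⁻ X in B, absPow (-b) (yco X) * (2 ^ (n + 1) * ∫⁻ Y, G Y) := by
          refine lintegral_mono fun X => ?_
          rw [lintegral_const_mul _ (by fun_prop)]
          gcongr
          refine (setLIntegral_le_lintegral _ _).trans ?_
          refine le_trans (le_of_eq ?_) (lintegral_comp_smul_add_le hGm h (X - t • X))
          refine lintegral_congr fun Z => ?_
          congr 1
          module
      _ = (∫⁻ X in B, absPow (-b) (yco X)) * (2 ^ (n + 1) * ∫⁻ Y, G Y) := by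
          rw [lintegral_mul_const _ (by fun_prop)]
      _ ≤ K * (2 ^ (n + 1) * ∫⁻ Y, G Y) := by
          gcongr
          simpa using hK 0
      _ = 2 ^ (n + 1) * K * 1 * ∫⁻ Y, G Y := by ring
      _ ≤ _ := by
          gcongr
          exact le_self_add
  · have ht1 : (1 - t) ≠ 0 := by linarith
    calc ∫⁻ X in B, ∫⁻ Z in B, absPow (-b) (yco X) * G (X + t • (Z - X))
        = ∫⁻ Z in B, ∫⁻ X in B, absPow (-b) (yco X) * G (X + t • (Z - X)) := by
          apply lintegral_lintegral_swap
          apply Measurable.aemeasurable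
          unfold Function.uncurry
          fun_prop
      _ ≤ ∫⁻ Z in B, 2 ^ (n + 1) *
            ∫⁻ Y, absPow (-b) ((1 - t)⁻¹ * (yco Y - t * yco Z)) * G Y := by
          refine lintegral_mono fun Z => ?_
          refine (setLIntegral_le_lintegral _ _).trans ?_
          refine le_trans (le_of_eq ?_) (lintegral_comp_smul_add_le (s := 1 - t)
            (h := fun Y => absPow (-b) ((1 - t)⁻¹ * (yco Y - t * yco Z)) * G Y)
            (by fun_prop) (by linarith) (t • Z))
          refine lintegral_congr fun X => ?_
          have h1 : X + t • (Z - X) = (1 - t) • X + t • Z := by module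
          have h2 : (1 - t)⁻¹ * (yco ((1 - t) • X + t • Z) - t * yco Z) = yco X := by
            rw [yco_add, yco_smul, yco_smul]
            field_simp
            ring
          rw [h1, h2]
      _ = 2 ^ (n + 1) * ∫⁻ Y, ∫⁻ Z in B,
            absPow (-b) ((1 - t)⁻¹ * (yco Y - t * yco Z)) * G Y := by
          rw [lintegral_const_mul', lintegral_lintegral_swap]
          · apply Measurable.aemeasurable
            unfold Function.uncurry
            fun_prop
          · finiteness
      _ ≤ 2 ^ (n + 1) * ∫⁻ Y, (absPow (-b) t * K) * G Y := by
          gcongr with Y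
          rw [lintegral_mul_const _ (by fun_prop)]
          gcongr
          calc ∫⁻ Z in B, absPow (-b) ((1 - t)⁻¹ * (yco Y - t * yco Z))
              ≤ ∫⁻ Z in B, absPow (-b) t * absPow (-b) (yco Z - t⁻¹ * yco Y) :=
                lintegral_mono fun Z => absPow_sub_div_le hb0 ht _ _
            _ = absPow (-b) t * ∫⁻ Z in B, absPow (-b) (yco Z - t⁻¹ * yco Y) :=
                lintegral_const_mul _ (by fun_prop)
            _ ≤ _ := by
                gcongr
                exact hK _
      _ = 2 ^ (n + 1) * K * absPow (-b) t * ∫⁻ Y, G Y := by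
          rw [lintegral_const_mul _ hGm]
          ring
      _ ≤ _ := by
          gcongr
          exact le_add_self

/-- Integrating a function over all segments joining two points of the unit ball, with a singular
weight at one end point, is controlled by its integral over the ball. -/
lemma exists_lintegral_segment_le (n : ℕ) {b : ℝ} (hb0 : 0 ≤ b) (hb1 : b < 1) :
    ∃ K : ℝ≥0∞, K ≠ ⊤ ∧ ∀ g : E n → ℝ≥0∞, Measurable g →
      ∫⁻ X in closedBall (0 : E n) 1, ∫⁻ Z in closedBall (0 : E n) 1, ∫⁻ t in Ioo (0 : ℝ) 1,
        absPow (-b) (yco X) * g (X + t • (Z - X))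
      ≤ K * ∫⁻ Y in closedBall (0 : E n) 1, g Y := by
  obtain ⟨K, hK, hKb⟩ := exists_lintegral_closedBall_absPow_sub_le n hb0 hb1
  obtain ⟨K₁, hK₁, hK₁b⟩ := exists_lintegral_absPow_sub_le hb0 hb1
  refine ⟨2 ^ (n + 1) * K * (1 + K₁), by finiteness, fun g hg => ?_⟩
  set B := closedBall (0 : E n) 1
  calc ∫⁻ X in B, ∫⁻ Z in B, ∫⁻ t in Ioo (0 : ℝ) 1, absPow (-b) (yco X) * g (X + t • (Z - X))
      = ∫⁻ X in B, ∫⁻ t in Ioo (0 : ℝ) 1, ∫⁻ Z in B,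
          absPow (-b) (yco X) * g (X + t • (Z - X)) := by
        refine lintegral_congr fun X => ?_
        apply lintegral_lintegral_swap
        apply Measurable.aemeasurable
        unfold Function.uncurry
        fun_prop
    _ = ∫⁻ t in Ioo (0 : ℝ) 1, ∫⁻ X in B, ∫⁻ Z in B,
          absPow (-b) (yco X) * g (X + t • (Z - X)) := by
        apply lintegral_lintegral_swap
        apply Measurable.aemeasurable
        unfold Function.uncurry
        apply Measurable.lintegral_prod_right'
          (f := fun p : (E n × ℝ) × E n =>
            absPow (-b) (yco p.1.1) * g (p.1.1 + p.1.2 • (p.2 - p.1.1)))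
        fun_prop
    _ ≤ ∫⁻ t in Ioo (0 : ℝ) 1, 2 ^ (n + 1) * K * (1 + absPow (-b) t) * ∫⁻ Y in B, g Y :=
        setLIntegral_mono' measurableSet_Ioo fun t ht =>
          lintegral_absPow_mul_comp_segment_le hb0 hKb hg ht
    _ = 2 ^ (n + 1) * K * (1 + ∫⁻ t in Ioo (0 : ℝ) 1, absPow (-b) t) * ∫⁻ Y in B, g Y := by
        rw [lintegral_mul_const _ (by fun_prop), lintegral_const_mul _ (by fun_prop),
          lintegral_add_left measurable_const]
        simp
    _ ≤ _ := by
        gcongr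
        refine le_trans (lintegral_mono_set ?_) (by simpa using hK₁b 0)
        exact fun t ht => ⟨by linarith [ht.1], ht.2.le⟩

lemma exists_absPow_mul_lintegral_segment_le {a : ℝ} (ha1 : -1 < a) (ha2 : a < 1) :
    ∃ K : ℝ≥0∞, K ≠ ⊤ ∧ ∀ y z : ℝ, |y| ≤ 1 → |z| ≤ 1 →
      absPow a y * ∫⁻ t in Ioo (0 : ℝ) 1, absPow (-a) (y + t * (z - y))
        ≤ K * absPow (-max (-a) 0) y := by
  rcases lt_or_ge a 0 with ha | ha
  · refine ⟨1, by simp, fun y z hy hz => ?_⟩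
    rw [max_eq_left (by linarith), neg_neg, one_mul]
    refine mul_le_of_le_one_right' ?_
    calc ∫⁻ t in Ioo (0 : ℝ) 1, absPow (-a) (y + t * (z - y))
        ≤ ∫⁻ t in Ioo (0 : ℝ) 1, 1 := by
          refine setLIntegral_mono' measurableSet_Ioo fun t ht => ?_
          unfold absPow
          rw [ENNReal.ofReal_le_one]
          apply Real.rpow_le_one (abs_nonneg _) _ (by linarith)
          rw [abs_le] at *
          obtain ⟨ht0, ht1⟩ := ht
          constructor <;> nlinarith
      _ = 1 := by simp
  · obtain ⟨K, hK, hKb⟩ := exists_lintegral_absPow_sub_le ha ha2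
    refine ⟨max K 1, by simp [hK], fun y z hy hz => ?_⟩
    rw [max_eq_right (by linarith : -a ≤ 0)]
    have hone : absPow (-0) y = 1 := by simp [absPow]
    rw [hone, mul_one]
    rcases ha.eq_or_lt with rfl | ha0
    · simp [absPow]
    refine le_trans ?_ (le_max_left K 1)
    rcases eq_or_ne y 0 with rfl | hy0
    · simp [absPow, Real.zero_rpow ha0.ne']
    have hyp := abs_pos.2 hy0
    obtain ⟨c, hc⟩ : ∃ c : ℝ, ∀ t ∈ Ioo (0 : ℝ) 1, y + t * (z - y) ≠ 0 →
        0 < |t - c| ∧ |y| * |t - c| ≤ |y + t * (z - y)| := by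
      rcases le_or_gt |z - y| |y| with h | h
      · refine ⟨1, fun t ht _ => ⟨abs_pos.2 (by linarith [ht.2]), ?_⟩⟩
        rw [abs_of_neg (by linarith [ht.2] : t - 1 < 0)]
        have h1 : |y| - |t * (z - y)| ≤ |y + t * (z - y)| := by
          simpa using abs_sub_abs_le_abs_sub y (-(t * (z - y)))
        rw [abs_mul, abs_of_pos ht.1] at h1
        nlinarith [ht.1, mul_le_mul_of_nonneg_left h ht.1.le]
      · have hzy : z - y ≠ 0 := abs_pos.1 (hyp.trans h)
        have key : ∀ t : ℝ, y + t * (z - y) = (z - y) * (t - -y / (z - y)) := by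
          intro t
          field_simp
          ring
        refine ⟨-y / (z - y), fun t ht hne => ⟨?_, ?_⟩⟩
        · rw [key] at hne
          exact abs_pos.2 (right_ne_zero_of_mul hne)
        · rw [key, abs_mul]
          gcongr
    calc absPow a y * ∫⁻ t in Ioo (0 : ℝ) 1, absPow (-a) (y + t * (z - y))
        = ∫⁻ t in Ioo (0 : ℝ) 1, absPow a y * absPow (-a) (y + t * (z - y)) := by
          rw [lintegral_const_mul _ (by fun_prop)]
      _ ≤ ∫⁻ t in Ioo (0 : ℝ) 1, absPow (-a) (t - c) := by
          refine setLIntegral_mono' measurableSet_Ioo fun t ht => ?_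
          rcases eq_or_ne (y + t * (z - y)) 0 with h0 | h0
          · simp [h0, absPow, Real.zero_rpow (neg_ne_zero.2 ha0.ne')]
          obtain ⟨h1, h2⟩ := hc t ht h0
          unfold absPow
          rw [← ENNReal.ofReal_mul (by positivity)]
          apply ENNReal.ofReal_le_ofReal
          calc |y| ^ a * |y + t * (z - y)| ^ (-a) ≤ |y| ^ a * (|y| * |t - c|) ^ (-a) := by
                gcongr ?_ * ?_
                exact Real.rpow_le_rpow_of_nonpos (by positivity) h2 (by linarith)
            _ = |t - c| ^ (-a) := by
                rw [Real.mul_rpow hyp.le h1.le, ← mul_assoc, ← Real.rpow_add hyp]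
                simp
      _ ≤ K := by
          refine le_trans (lintegral_mono_set ?_) (hKb c)
          exact fun t ht => ⟨by linarith [ht.1], ht.2.le⟩

lemma absPow_half_sq (p s : ℝ) : absPow (p / 2) s ^ 2 = absPow p s := by
  unfold absPow
  rw [← ENNReal.ofReal_pow (by positivity), ← Real.rpow_natCast, ← Real.rpow_mul (abs_nonneg _)]
  norm_num

lemma enorm_sub_le_lintegral_fderiv_segment {n : ℕ} {v : E n → ℝ} {L : NNReal}
    (hv : LipschitzWith L v) (X Z : E n)
    (hd : ∀ᵐ t ∂(volume.restrict (Ioo (0 : ℝ) 1)), DifferentiableAt ℝ v (X + t • (Z - X))) :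
    ‖v X - v Z‖ₑ ≤ ‖Z - X‖ₑ * ∫⁻ t in Ioo (0 : ℝ) 1, ‖fderiv ℝ v (X + t • (Z - X))‖ₑ := by
  set φ : ℝ → ℝ := fun t => v (X + t • (Z - X)) with hφ
  have hφL : LipschitzWith (L * ‖Z - X‖₊) φ := by
    refine LipschitzWith.of_dist_le_mul fun s t => ?_
    refine (hv.dist_le_mul _ _).trans ?_
    rw [dist_add_left, dist_eq_norm (s • (Z - X)), ← sub_smul, norm_smul, Real.dist_eq,
      Real.norm_eq_abs]
    push_cast
    rw [mul_assoc, mul_comm (|s - t|)]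
  have hftc := (hφL.lipschitzOnWith (s := uIcc 0 1)).absolutelyContinuousOnInterval
    |>.integral_deriv_eq_sub
  have h0 : φ 0 = v X := by simp [hφ]
  have h1 : φ 1 = v Z := by simp [hφ]
  rw [h0, h1, intervalIntegral.integral_of_le zero_le_one, integral_Ioc_eq_integral_Ioo] at hftc
  rw [← enorm_neg, neg_sub, ← hftc]
  refine (enorm_integral_le_lintegral_enorm _).trans ?_
  rw [← lintegral_const_mul']
  swap
  · simp
  refine lintegral_mono_ae ?_
  filter_upwards [hd] with t ht
  have hline : HasDerivAt (fun t : ℝ => X + t • (Z - X)) (Z - X) t := by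
    simpa using ((hasDerivAt_id t).smul_const (Z - X)).const_add X
  have hder : HasDerivAt φ (fderiv ℝ v (X + t • (Z - X)) (Z - X)) t :=
    ht.hasFDerivAt.comp_hasDerivAt t hline
  rw [hder.deriv, mul_comm]
  exact ContinuousLinearMap.le_opENorm _ _

lemma sq_enorm_sub_le_lintegral_segment {n : ℕ} (a : ℝ) {v : E n → ℝ} {L : NNReal}
    (hv : LipschitzWith L v) {X Z : E n} (hX : X ∈ closedBall (0 : E n) 1)
    (hZ : Z ∈ closedBall (0 : E n) 1)
    (hd : ∀ᵐ t ∂(volume.restrict (Ioo (0 : ℝ) 1)),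
      DifferentiableAt ℝ v (X + t • (Z - X)) ∧ yco (X + t • (Z - X)) ≠ 0) :
    ‖v X - v Z‖ₑ ^ 2 ≤ 4 * ((∫⁻ t in Ioo (0 : ℝ) 1, absPow (-a) (yco (X + t • (Z - X)))) *
      ∫⁻ t in Ioo (0 : ℝ) 1, absPow a (yco (X + t • (Z - X))) *
        ‖fderiv ℝ v (X + t • (Z - X))‖ₑ ^ 2) := by
  have hfd : Measurable fun Y => ‖fderiv ℝ v Y‖ₑ := (measurable_fderiv ℝ v).enorm
  have hdist : ‖Z - X‖ₑ ≤ 2 := by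
    rw [mem_closedBall, dist_zero_right] at hX hZ
    rw [← ofReal_norm, ENNReal.ofReal_le_ofNat]
    calc ‖Z - X‖ ≤ ‖Z‖ + ‖X‖ := norm_sub_le _ _
      _ ≤ 2 := by linarith
  have h1 := enorm_sub_le_lintegral_fderiv_segment hv X Z (hd.mono fun _ h => h.1)
  set f : ℝ → ℝ≥0∞ := fun t => absPow (-a / 2) (yco (X + t • (Z - X))) with hf
  set g : ℝ → ℝ≥0∞ := fun t =>
    absPow (a / 2) (yco (X + t • (Z - X))) * ‖fderiv ℝ v (X + t • (Z - X))‖ₑ with hg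
  have hgm : Measurable g := by
    have h : Measurable fun t : ℝ => ‖fderiv ℝ v (X + t • (Z - X))‖ₑ := hfd.comp (by fun_prop)
    fun_prop
  have h2 : ∫⁻ t in Ioo (0 : ℝ) 1, ‖fderiv ℝ v (X + t • (Z - X))‖ₑ
      ≤ ∫⁻ t in Ioo (0 : ℝ) 1, (f * g) t := by
    refine lintegral_mono_ae ?_
    filter_upwards [hd] with t ht
    have hone : absPow (-a / 2) (yco (X + t • (Z - X))) * absPow (a / 2) (yco (X + t • (Z - X)))
        = 1 := by
      unfold absPow
      rw [← ENNReal.ofReal_mul (by positivity), ← Real.rpow_add (abs_pos.2 ht.2)]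
      rw [neg_div, neg_add_cancel, Real.rpow_zero, ENNReal.ofReal_one]
    simp only [hf, hg, Pi.mul_apply]
    rw [← mul_assoc, hone, one_mul]
  have h3 := ENNReal.lintegral_mul_le_Lp_mul_Lq (volume.restrict (Ioo (0 : ℝ) 1))
    Real.HolderConjugate.two_two (f := f) (g := g) (by fun_prop) hgm.aemeasurable
  have hfsq : ∀ t, f t ^ (2 : ℝ) = absPow (-a) (yco (X + t • (Z - X))) := fun t => by
    rw [ENNReal.rpow_two, hf, absPow_half_sq]
  have hgsq : ∀ t, g t ^ (2 : ℝ) = absPow a (yco (X + t • (Z - X))) *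
      ‖fderiv ℝ v (X + t • (Z - X))‖ₑ ^ 2 := fun t => by
    rw [ENNReal.rpow_two, hg, mul_pow, absPow_half_sq]
  simp only [hfsq, hgsq] at h3
  have hsq : ∀ x : ℝ≥0∞, (x ^ (1 / 2 : ℝ)) ^ 2 = x := fun x => by
    rw [← ENNReal.rpow_natCast, ← ENNReal.rpow_mul]
    norm_num
  calc ‖v X - v Z‖ₑ ^ 2 ≤ (2 * _) ^ 2 := by
        gcongr
        exact h1.trans (mul_le_mul' hdist (h2.trans h3))
    _ = _ := by
        rw [mul_pow, mul_pow, hsq, hsq]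
        norm_num

lemma ae_segment_notMem {n : ℕ} {N : Set (E n)} (hN : MeasurableSet N)
    (hN0 : ∀ᵐ Y ∂(volume.restrict (closedBall (0 : E n) 1)), Y ∉ N) :
    ∀ᵐ X ∂(volume.restrict (closedBall (0 : E n) 1)),
      ∀ᵐ Z ∂(volume.restrict (closedBall (0 : E n) 1)),
        ∀ᵐ t ∂(volume.restrict (Ioo (0 : ℝ) 1)), X + t • (Z - X) ∉ N := by
  obtain ⟨K, hK, h⟩ := exists_lintegral_segment_le n le_rfl one_pos
  set g : E n → ℝ≥0∞ := N.indicator 1 with hg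
  have hgm : Measurable g := measurable_one.indicator hN
  have h0 : ∫⁻ Y in closedBall (0 : E n) 1, g Y = 0 := by
    rw [lintegral_eq_zero_iff hgm]
    filter_upwards [hN0] with Y hY
    simp [hg, hY]
  have hone : ∀ y, absPow (-0) y = 1 := fun y => by simp [absPow]
  have h1 := h g hgm
  simp only [h0, mul_zero, nonpos_iff_eq_zero, hone, one_mul] at h1
  rw [lintegral_eq_zero_iff] at h1
  swap
  · apply Measurable.lintegral_prod_right'
      (f := fun p : E n × E n => ∫⁻ t in Ioo (0 : ℝ) 1, g (p.1 + t • (p.2 - p.1)))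
    apply Measurable.lintegral_prod_right'
      (f := fun p : (E n × E n) × ℝ => g (p.1.1 + p.2 • (p.1.2 - p.1.1)))
    fun_prop
  filter_upwards [h1] with X hX
  rw [Pi.zero_apply, lintegral_eq_zero_iff] at hX
  swap
  · apply Measurable.lintegral_prod_right'
      (f := fun p : E n × ℝ => g (X + p.2 • (p.1 - X)))
    fun_prop
  filter_upwards [hX] with Z hZ
  rw [Pi.zero_apply, lintegral_eq_zero_iff (by fun_prop)] at hZ
  filter_upwards [hZ] with t ht hmem
  simp [hg, hmem] at ht

/-- A weighted Poincaré inequality in terms of the double integral of the oscillation. -/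
lemma exists_lintegral_sq_enorm_sub_le (n : ℕ) {a : ℝ} (ha1 : -1 < a) (ha2 : a < 1) :
    ∃ K : ℝ≥0∞, K ≠ ⊤ ∧ ∀ (v : E n → ℝ) (L : NNReal), LipschitzWith L v →
      ∫⁻ X in closedBall (0 : E n) 1, ∫⁻ Z in closedBall (0 : E n) 1,
        absPow a (yco X) * ‖v X - v Z‖ₑ ^ 2
      ≤ K * ∫⁻ Y in closedBall (0 : E n) 1, absPow a (yco Y) * ‖fderiv ℝ v Y‖ₑ ^ 2 := by
  obtain ⟨K₁, hK₁, h₁⟩ := exists_lintegral_segment_le n (b := max (-a) 0) (le_max_right _ _)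
    (max_lt (by linarith) one_pos)
  obtain ⟨K₂, hK₂, h₂⟩ := exists_absPow_mul_lintegral_segment_le ha1 ha2
  refine ⟨4 * K₂ * K₁, by finiteness, fun v L hv => ?_⟩
  set B := closedBall (0 : E n) 1 with hB
  have hBm : MeasurableSet B := measurableSet_closedBall
  have hfd : Measurable fun Y => ‖fderiv ℝ v Y‖ₑ := (measurable_fderiv ℝ v).enorm
  set g : E n → ℝ≥0∞ := fun Y => absPow a (yco Y) * ‖fderiv ℝ v Y‖ₑ ^ 2 with hg
  have hgm : Measurable g := by fun_prop
  set N : Set (E n) := {Y | DifferentiableAt ℝ v Y ∧ yco Y ≠ 0}ᶜ with hN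
  have hNm : MeasurableSet N := by
    refine ((measurableSet_of_differentiableAt ℝ v).inter ?_).compl
    exact (measurable_yco (measurableSet_singleton 0)).compl
  have hN0 : ∀ᵐ Y ∂(volume.restrict B), Y ∉ N := by
    filter_upwards [ae_closedBall_yco_ne_zero n,
      ae_restrict_of_ae (s := B) (hv.ae_differentiableAt (μ := volume))] with Y h1 h2
    simp [hN, h1, h2]
  have hseg := ae_segment_notMem hNm hN0
  calc ∫⁻ X in B, ∫⁻ Z in B, absPow a (yco X) * ‖v X - v Z‖ₑ ^ 2
      ≤ ∫⁻ X in B, ∫⁻ Z in B, 4 * K₂ * ∫⁻ t in Ioo (0 : ℝ) 1,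
          absPow (-max (-a) 0) (yco X) * g (X + t • (Z - X)) := by
        refine lintegral_mono_ae ?_
        filter_upwards [hseg, ae_restrict_mem hBm] with X hX hXB
        refine lintegral_mono_ae ?_
        filter_upwards [hX, ae_restrict_mem hBm] with Z hZ hZB
        have h3 := sq_enorm_sub_le_lintegral_segment a hv hXB hZB
          (hZ.mono fun t ht => by simpa [hN] using ht)
        have h4 := h₂ (yco X) (yco Z) (abs_coord_le_one hXB _) (abs_coord_le_one hZB _)
        rw [lintegral_const_mul _ (by fun_prop)]
        calc absPow a (yco X) * ‖v X - v Z‖ₑ ^ 2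
            ≤ absPow a (yco X) * (4 *
                ((∫⁻ t in Ioo (0 : ℝ) 1, absPow (-a) (yco (X + t • (Z - X)))) *
                ∫⁻ t in Ioo (0 : ℝ) 1, g (X + t • (Z - X)))) := by gcongr
          _ = 4 * (absPow a (yco X) *
                ∫⁻ t in Ioo (0 : ℝ) 1, absPow (-a) (yco X + t * (yco Z - yco X))) *
                ∫⁻ t in Ioo (0 : ℝ) 1, g (X + t • (Z - X)) := by
              simp only [yco_add, yco_smul, yco_sub]
              ring
          _ ≤ 4 * (K₂ * absPow (-max (-a) 0) (yco X)) *
                ∫⁻ t in Ioo (0 : ℝ) 1, g (X + t • (Z - X)) := by gcongr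
          _ = _ := by ring
    _ = 4 * K₂ * ∫⁻ X in B, ∫⁻ Z in B, ∫⁻ t in Ioo (0 : ℝ) 1,
          absPow (-max (-a) 0) (yco X) * g (X + t • (Z - X)) := by
        simp_rw [lintegral_const_mul' (4 * K₂) _ (by finiteness)]
    _ ≤ 4 * K₂ * (K₁ * ∫⁻ Y in B, g Y) := by
        gcongr
        exact h₁ g hgm
    _ = _ := by ring

lemma lintegral_closedBall_absPow_ne_top (n : ℕ) {a : ℝ} (ha : -1 < a) :
    ∫⁻ X in closedBall (0 : E n) 1, absPow a (yco X) ≠ ⊤ := by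
  rcases le_or_gt a 0 with h | h
  · obtain ⟨K, hK, hKb⟩ := exists_lintegral_closedBall_absPow_sub_le n (b := -a)
      (by linarith) (by linarith)
    exact ne_top_of_le_ne_top hK (by simpa using hKb 0)
  · have hfin : volume (closedBall (0 : E n) 1) ≠ ⊤ := measure_closedBall_lt_top.ne
    refine ne_top_of_le_ne_top hfin ?_
    rw [← setLIntegral_one]
    refine setLIntegral_mono' measurableSet_closedBall fun X hX => ?_
    unfold absPow
    rw [ENNReal.ofReal_le_one]
    exact Real.rpow_le_one (abs_nonneg _) (abs_coord_le_one hX _) h.le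

lemma setIntegral_abs_yco_rpow_mul_sq {n : ℕ} (a : ℝ) {f : E n → ℝ} (hf : Measurable f)
    (B : Set (E n)) :
    ∫ X in B, |yco X| ^ a * f X ^ 2 = (∫⁻ X in B, absPow a (yco X) * ‖f X‖ₑ ^ 2).toReal := by
  rw [integral_eq_lintegral_of_nonneg_ae (Filter.Eventually.of_forall fun X => by positivity)
    (by fun_prop)]
  congr 1
  refine lintegral_congr fun X => ?_
  rw [ENNReal.ofReal_mul (by positivity), absPow, Real.enorm_eq_ofReal_abs,
    ← ENNReal.ofReal_pow (abs_nonneg _), sq_abs]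

/-- **Weighted Poincaré inequality.**  Let `a ∈ (−1,1)` and `ε > 0`.  There is `C`,
depending only on `n, a, ε`, such that every Lipschitz function `u` on the closed unit ball
of `ℝ^{n+1}` whose zero set has measure at least `ε |B₁|` satisfies
`∫_{B₁} |y|^a u² ≤ C ∫_{B₁} |y|^a |∇u|²`. -/
theorem weighted_poincare (n : ℕ) (hn : 1 ≤ n) (a ε : ℝ)
    (ha1 : -1 < a) (ha2 : a < 1) (hε : 0 < ε) :
    ∃ C > (0:ℝ), ∀ (u : E n → ℝ) (L : NNReal),
      LipschitzOnWith L u (Metric.closedBall (0 : E n) 1) →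
      ENNReal.ofReal ε * volume (Metric.closedBall (0 : E n) 1)
        ≤ volume {X ∈ Metric.closedBall (0 : E n) 1 | u X = 0} →
      ∫ X in Metric.closedBall (0 : E n) 1, |yco X| ^ a * u X ^ 2
        ≤ C * ∫ X in Metric.closedBall (0 : E n) 1, |yco X| ^ a * ‖fderiv ℝ u X‖ ^ 2 := by
  obtain ⟨K, hK, hKb⟩ := exists_lintegral_sq_enorm_sub_le n ha1 ha2
  set B := closedBall (0 : E n) 1 with hB
  have hBm : MeasurableSet B := measurableSet_closedBall
  set m : ℝ≥0∞ := ENNReal.ofReal ε * volume B with hm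
  have hm0 : m ≠ 0 :=
    mul_ne_zero (ENNReal.ofReal_pos.2 hε).ne' (measure_closedBall_pos _ _ one_pos).ne'
  have hmt : m ≠ ⊤ := ENNReal.mul_ne_top ENNReal.ofReal_ne_top measure_closedBall_lt_top.ne
  refine ⟨(m⁻¹ * K).toReal + 1, by positivity, fun u L hu hzero => ?_⟩
  obtain ⟨v, hv, huv⟩ := hu.extend_real
  have hvm : Measurable v := hv.continuous.measurable
  have hfd : Measurable fun Y => ‖fderiv ℝ v Y‖ := (measurable_fderiv ℝ v).norm
  have hlhs : ∫ X in B, |yco X| ^ a * u X ^ 2 = ∫ X in B, |yco X| ^ a * v X ^ 2 :=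
    setIntegral_congr_fun hBm fun X hX => by simp only [huv hX]
  have hrhs : ∫ X in B, |yco X| ^ a * ‖fderiv ℝ u X‖ ^ 2
      = ∫ X in B, |yco X| ^ a * ‖fderiv ℝ v X‖ ^ 2 := by
    refine integral_congr_ae ?_
    filter_upwards [ae_restrict_mem hBm, ae_restrict_of_ae (s := B)
      (measure_eq_zero_iff_ae_notMem.1 (Measure.addHaar_sphere volume (0 : E n) 1))] with X hXB hXS
    have hX : X ∈ ball (0 : E n) 1 :=
      mem_ball.2 (lt_of_le_of_ne (mem_closedBall.1 hXB) fun h => hXS (mem_sphere.2 h))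
    have hev : u =ᶠ[nhds X] v := by
      filter_upwards [isOpen_ball.mem_nhds hX] with Y hY using huv (ball_subset_closedBall hY)
    simp only [hev.fderiv_eq]
  rw [hlhs, hrhs, setIntegral_abs_yco_rpow_mul_sq a hvm, setIntegral_abs_yco_rpow_mul_sq a hfd]
  simp only [enorm_norm]
  set R := ∫⁻ X in B, absPow a (yco X) * ‖fderiv ℝ v X‖ₑ ^ 2 with hR
  have hRt : R ≠ ⊤ := by
    refine ne_top_of_le_ne_top (b := (∫⁻ X in B, absPow a (yco X)) * (L : ℝ≥0∞) ^ 2)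
      (ENNReal.mul_ne_top (lintegral_closedBall_absPow_ne_top n ha1) (by finiteness)) ?_
    rw [← lintegral_mul_const _ (by fun_prop)]
    refine lintegral_mono fun X => ?_
    gcongr
    rw [enorm_le_coe]
    exact norm_fderiv_le_of_lipschitz ℝ hv
  set S := {X ∈ B | u X = 0} with hS
  have hSB : S ⊆ B := fun X hX => hX.1
  have hSm : MeasurableSet S := by
    have : S = B ∩ v ⁻¹' {0} := by
      ext X
      simp only [hS, mem_ofPred_eq, mem_inter_iff, mem_preimage, mem_singleton_iff]
      exact and_congr_right fun hX => by rw [huv hX]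
    rw [this]
    exact hBm.inter (hvm (measurableSet_singleton 0))
  have hmain : m * ∫⁻ X in B, absPow a (yco X) * ‖v X‖ₑ ^ 2 ≤ K * R := by
    calc m * ∫⁻ X in B, absPow a (yco X) * ‖v X‖ₑ ^ 2
        ≤ volume S * ∫⁻ X in B, absPow a (yco X) * ‖v X‖ₑ ^ 2 := by gcongr
      _ = ∫⁻ X in B, ∫⁻ Z in S, absPow a (yco X) * ‖v X - v Z‖ₑ ^ 2 := by
          rw [← lintegral_const_mul _ (by fun_prop)]
          refine lintegral_congr fun X => ?_
          rw [mul_comm, ← setLIntegral_const]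
          refine setLIntegral_congr_fun hSm fun Z hZ => ?_
          simp only [← huv hZ.1, hZ.2, sub_zero]
      _ ≤ ∫⁻ X in B, ∫⁻ Z in B, absPow a (yco X) * ‖v X - v Z‖ₑ ^ 2 :=
          lintegral_mono fun X => lintegral_mono_set hSB
      _ ≤ K * R := hKb v L hv
  have hle : ∫⁻ X in B, absPow a (yco X) * ‖v X‖ₑ ^ 2 ≤ m⁻¹ * K * R := by
    rw [mul_assoc, ← ENNReal.div_eq_inv_mul, ENNReal.le_div_iff_mul_le (.inl hm0) (.inl hmt),
      mul_comm]
    exact hmain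
  have hCt : m⁻¹ * K ≠ ⊤ := ENNReal.mul_ne_top (ENNReal.inv_ne_top.2 hm0) hK
  calc (∫⁻ X in B, absPow a (yco X) * ‖v X‖ₑ ^ 2).toReal
      ≤ (m⁻¹ * K * R).toReal := ENNReal.toReal_mono (ENNReal.mul_ne_top hCt hRt) hle
    _ = (m⁻¹ * K).toReal * R.toReal := ENNReal.toReal_mul
    _ ≤ ((m⁻¹ * K).toReal + 1) * R.toReal := by
        gcongr
        linarith
end
end
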